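/- Let ψ(t,·) be a smooth positive density on T^n with marginal ψ^ξ, let F_t^i be the conditional averages of ∂ᵢV, and let A_t be the weighted Helmholtz projection defined by ∫_{T²} ∇A_t·∇g ψ^ξ = ∫_{T²} F_t·∇g ψ^ξ for all g ∈ H¹(T²)/ℝ. Then ∫_{T^n} (∂₁A_t − F_t^1) ∂₁ln(ψ/ψ_∞) ψ + ∫_{T^n} (∂₂A_t − F_t^2) ∂₂ln(ψ/ψ_∞) ψ ≤ 0, and in fact it equals −∫_{T²} |∇A_t − F_t|² ψ^ξ. -/

import Mathlib

open MeasureTheory Real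

noncomputable section

/-- The unit square, fundamental domain of the torus `T²` (the range of `ξ(x) = (x₁,x₂)`). -/
def Q2 : Set (ℝ × ℝ) := Set.Icc 0 1 ×ˢ Set.Icc 0 1

/-- The unit cube, fundamental domain of the fiber torus `T^{n−2}` (here of dimension `m`). -/
def cube (m : ℕ) : Set (Fin m → ℝ) := Set.Icc 0 1

/-- Partial derivative in `x₁` of a function of `(x₁,x₂)`. -/
def pd1 (f : ℝ × ℝ → ℝ) (x : ℝ × ℝ) : ℝ := deriv (fun u => f (u, x.2)) x.1

/-- Partial derivative in `x₂` of a function of `(x₁,x₂)`. -/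
def pd2 (f : ℝ × ℝ → ℝ) (x : ℝ × ℝ) : ℝ := deriv (fun u => f (x.1, u)) x.2

/-- Partial derivative in `x₁` of a function on `T^n = T² × T^m`. -/
def pdx1 {m : ℕ} (f : ℝ × ℝ → (Fin m → ℝ) → ℝ) (x : ℝ × ℝ) (y : Fin m → ℝ) : ℝ :=
  deriv (fun u => f (u, x.2) y) x.1

/-- Partial derivative in `x₂` of a function on `T^n = T² × T^m`. -/
def pdx2 {m : ℕ} (f : ℝ × ℝ → (Fin m → ℝ) → ℝ) (x : ℝ × ℝ) (y : Fin m → ℝ) : ℝ :=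
  deriv (fun u => f (x.1, u) y) x.2

/-- Partial derivative in the fiber variable `x_{i+3}` of a function on `T^n = T² × T^m`. -/
def pdy {m : ℕ} (i : Fin m) (f : ℝ × ℝ → (Fin m → ℝ) → ℝ) (x : ℝ × ℝ)
    (y : Fin m → ℝ) : ℝ :=
  deriv (fun u => f x (Function.update y i u)) (y i)

/-- `f` is periodic in all `n = m + 2` variables, i.e. a function on the torus `T^n`. -/
def PerN {m : ℕ} (f : ℝ × ℝ → (Fin m → ℝ) → ℝ) : Prop :=
  (∀ x₁ x₂ y, f (x₁ + 1, x₂) y = f (x₁, x₂) y) ∧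
  (∀ x₁ x₂ y, f (x₁, x₂ + 1) y = f (x₁, x₂) y) ∧
  (∀ x y (i : Fin m), f x (y + Pi.single i 1) = f x y)

/-- The marginal density of `ψ` along `ξ(x) = (x₁,x₂)` (integral over the fiber `T^m`). -/
def marg {m : ℕ} (ψ : ℝ × ℝ → (Fin m → ℝ) → ℝ) (x : ℝ × ℝ) : ℝ :=
  ∫ y in cube m, ψ x y

/-- The free energy `A(x₁,x₂) = −ln ∫_{fiber} e^{−V} dx₃…dx_n` (with `β = 1`). -/
def freeEnergy {m : ℕ} (V : ℝ × ℝ → (Fin m → ℝ) → ℝ) (x : ℝ × ℝ) : ℝ :=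
  - Real.log (∫ y in cube m, Real.exp (-V x y))

/-- The equilibrium density `ψ_∞ = e^{−(V − A∘ξ)}` of the PABF dynamics. -/
def psiInf {m : ℕ} (V : ℝ × ℝ → (Fin m → ℝ) → ℝ) (x : ℝ × ℝ) (y : Fin m → ℝ) : ℝ :=
  Real.exp (-(V x y - freeEnergy V x))

/-- First component of the mean force `F`: conditional average of `∂₁V` given `ξ = (x₁,x₂)`. -/
def F1 {m : ℕ} (ψ V : ℝ × ℝ → (Fin m → ℝ) → ℝ) (x : ℝ × ℝ) : ℝ :=
  (∫ y in cube m, pdx1 V x y * ψ x y) / marg ψ x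

/-- Second component of the mean force `F`: conditional average of `∂₂V` given `ξ = (x₁,x₂)`. -/
def F2 {m : ℕ} (ψ V : ℝ × ℝ → (Fin m → ℝ) → ℝ) (x : ℝ × ℝ) : ℝ :=
  (∫ y in cube m, pdx2 V x y * ψ x y) / marg ψ x

/-- `g` is `ℤ²`-periodic, i.e. a function on the torus `T²`. -/
def Per2 (g : ℝ × ℝ → ℝ) : Prop :=
  (∀ x y, g (x + 1, y) = g (x, y)) ∧ (∀ x y, g (x, y + 1) = g (x, y))

section ParametricIntegral

variable {E Y : Type} [NormedAddCommGroup E] [NormedSpace ℝ E]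
  [NormedAddCommGroup Y] [NormedSpace ℝ Y]

/-- The partial differential in the first variable of a function on a product space. -/
def fderivFst {F : Type} [NormedAddCommGroup F] [NormedSpace ℝ F]
    (f : E × Y → F) (p : E × Y) : E →L[ℝ] F :=
  (fderiv ℝ f p).comp (ContinuousLinearMap.inl ℝ E Y)

theorem contDiff_fderivFst {F : Type} [NormedAddCommGroup F] [NormedSpace ℝ F]
    {f : E × Y → F} {k n : WithTop ℕ∞} (hf : ContDiff ℝ n f) (hk : k + 1 ≤ n) :
    ContDiff ℝ k (fderivFst f) :=
  (hf.fderiv_right hk).clm_comp contDiff_const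

variable [FiniteDimensional ℝ E] [MeasurableSpace Y] [BorelSpace Y] [SecondCountableTopology Y]
  {μ : Measure Y} [IsLocallyFiniteMeasure μ]

theorem hasFDerivAt_setIntegral_of_contDiff {F : Type} [NormedAddCommGroup F] [NormedSpace ℝ F]
    {f : E × Y → F} (hf : ContDiff ℝ 1 f) {K : Set Y} (hK : IsCompact K) (x : E) :
    HasFDerivAt (fun x => ∫ y in K, f (x, y) ∂μ) (∫ y in K, fderivFst f (x, y) ∂μ) x := by
  have hc : Continuous (fderivFst f) := (contDiff_fderivFst (k := 0) hf (by simp)).continuous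
  obtain ⟨U, hU, hUx⟩ := exists_compact_mem_nhds x
  obtain ⟨M, hM⟩ := (hU.prod hK).bddAbove_image hc.norm.continuousOn
  have hfin : IsFiniteMeasure (μ.restrict K) := ⟨by simpa using hK.measure_lt_top⟩
  refine hasFDerivAt_integral_of_dominated_of_fderiv_le (bound := fun _ => M)
    (F' := fun x y => fderivFst f (x, y)) hUx ?_ ?_ ?_ ?_ ?_ ?_
  · exact Filter.Eventually.of_forall fun x' =>
      (hf.continuous.comp (Continuous.prodMk_right x')).aestronglyMeasurable
  · exact (hf.continuous.comp (Continuous.prodMk_right x)).continuousOn.integrableOn_compact hK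
  · exact (hc.comp (Continuous.prodMk_right x)).aestronglyMeasurable
  · filter_upwards [ae_restrict_mem hK.measurableSet] with y hy x' hx'
    exact hM ⟨(x', y), ⟨hx', hy⟩, rfl⟩
  · exact integrable_const M
  · refine Filter.Eventually.of_forall fun y x' _ => ?_
    have h := (hf.differentiable (by simp) (x', y)).hasFDerivAt
    exact h.comp x' (hasFDerivAt_prodMk_left x' y)

theorem contDiff_setIntegral_nat (n : ℕ) :
    ∀ {F : Type} [NormedAddCommGroup F] [NormedSpace ℝ F] {f : E × Y → F},
      ContDiff ℝ n f → ∀ {K : Set Y}, IsCompact K →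
        ContDiff ℝ n (fun x => ∫ y in K, f (x, y) ∂μ) := by
  induction n with
  | zero =>
    intro F _ _ f hf K hK
    have hc : Continuous (Function.uncurry fun x y => f (x, y)) := hf.continuous
    exact contDiff_zero.2 (continuous_parametric_integral_of_continuous hc hK)
  | succ n ih =>
    intro F _ _ f hf K hK
    have hf1 : ContDiff ℝ 1 f := hf.of_le (by exact_mod_cast Nat.le_add_left 1 n)
    exact contDiff_succ_iff_hasFDerivAt.2
      ⟨_, ih (contDiff_fderivFst hf (by norm_cast)) hK,
        hasFDerivAt_setIntegral_of_contDiff hf1 hK⟩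

theorem contDiff_setIntegral {F : Type} [NormedAddCommGroup F] [NormedSpace ℝ F]
    {f : E × Y → F} (hf : ContDiff ℝ (⊤ : ℕ∞) f) {K : Set Y} (hK : IsCompact K) :
    ContDiff ℝ (⊤ : ℕ∞) (fun x => ∫ y in K, f (x, y) ∂μ) :=
  contDiff_infty.2 fun n => contDiff_setIntegral_nat n (contDiff_infty.1 hf n) hK

end ParametricIntegral

theorem isCompact_cube (m : ℕ) : IsCompact (cube m) := isCompact_Icc

theorem isCompact_Q2 : IsCompact Q2 := isCompact_Icc.prod isCompact_Icc

theorem pd1_eq_fderiv {g : ℝ × ℝ → ℝ} (hg : Differentiable ℝ g) (x : ℝ × ℝ) :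
    pd1 g x = fderiv ℝ g x (1, 0) :=
  ((hg x).hasFDerivAt.comp_hasDerivAt x.1
    ((hasDerivAt_id x.1).prodMk (hasDerivAt_const x.1 x.2))).deriv

theorem pd2_eq_fderiv {g : ℝ × ℝ → ℝ} (hg : Differentiable ℝ g) (x : ℝ × ℝ) :
    pd2 g x = fderiv ℝ g x (0, 1) :=
  ((hg x).hasFDerivAt.comp_hasDerivAt x.2
    ((hasDerivAt_const x.2 x.1).prodMk (hasDerivAt_id x.2))).deriv

theorem pdx1_eq_fderivFst {m : ℕ} {f : ℝ × ℝ → (Fin m → ℝ) → ℝ}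
    (hf : Differentiable ℝ (fun p : (ℝ × ℝ) × (Fin m → ℝ) => f p.1 p.2))
    (x : ℝ × ℝ) (y : Fin m → ℝ) :
    pdx1 f x y = fderivFst (fun p : (ℝ × ℝ) × (Fin m → ℝ) => f p.1 p.2) (x, y) (1, 0) :=
  (HasFDerivAt.comp_hasDerivAt (f := fun u => ((u, x.2), y)) x.1 (hf (x, y)).hasFDerivAt
    (((hasDerivAt_id x.1).prodMk (hasDerivAt_const x.1 x.2)).prodMk
      (hasDerivAt_const x.1 y))).deriv

theorem pdx2_eq_fderivFst {m : ℕ} {f : ℝ × ℝ → (Fin m → ℝ) → ℝ}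
    (hf : Differentiable ℝ (fun p : (ℝ × ℝ) × (Fin m → ℝ) => f p.1 p.2))
    (x : ℝ × ℝ) (y : Fin m → ℝ) :
    pdx2 f x y = fderivFst (fun p : (ℝ × ℝ) × (Fin m → ℝ) => f p.1 p.2) (x, y) (0, 1) :=
  (HasFDerivAt.comp_hasDerivAt (f := fun u => ((x.1, u), y)) x.2 (hf (x, y)).hasFDerivAt
    (((hasDerivAt_const x.2 x.1).prodMk (hasDerivAt_id x.2)).prodMk
      (hasDerivAt_const x.2 y))).deriv

section Marginal

variable {m : ℕ} {ψ V : ℝ × ℝ → (Fin m → ℝ) → ℝ}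

theorem contDiff_marg
    (hψ : ContDiff ℝ (⊤ : ℕ∞) (fun p : (ℝ × ℝ) × (Fin m → ℝ) => ψ p.1 p.2)) :
    ContDiff ℝ (⊤ : ℕ∞) (marg ψ) :=
  contDiff_setIntegral hψ (isCompact_cube m)

theorem integrableOn_cube {f : (ℝ × ℝ) × (Fin m → ℝ) → ℝ} (hf : Continuous f) (x : ℝ × ℝ) :
    IntegrableOn (fun y => f (x, y)) (cube m) :=
  (hf.comp (Continuous.prodMk_right x)).continuousOn.integrableOn_compact (isCompact_cube m)

theorem marg_pos (hψ : Continuous (fun p : (ℝ × ℝ) × (Fin m → ℝ) => ψ p.1 p.2))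
    (hpos : ∀ x y, 0 < ψ x y) (x : ℝ × ℝ) : 0 < marg ψ x := by
  refine (setIntegral_pos_iff_support_of_nonneg_ae
    (Filter.Eventually.of_forall fun y => (hpos x y).le) (integrableOn_cube hψ x)).2 ?_
  have hs : (Function.support fun y => ψ x y) = Set.univ :=
    Set.eq_univ_of_forall fun y => (hpos x y).ne'
  rw [hs, Set.univ_inter, cube, Real.volume_Icc_pi]
  simp

theorem per2_marg (h : PerN ψ) : Per2 (marg ψ) :=
  ⟨fun x₁ x₂ => by simp only [marg, h.1], fun x₁ x₂ => by simp only [marg, h.2.1]⟩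

theorem continuous_integral_fderivFst_mul
    (hψ : ContDiff ℝ (⊤ : ℕ∞) (fun p : (ℝ × ℝ) × (Fin m → ℝ) => ψ p.1 p.2))
    (hV : ContDiff ℝ (⊤ : ℕ∞) (fun p : (ℝ × ℝ) × (Fin m → ℝ) => V p.1 p.2)) (v : ℝ × ℝ) :
    Continuous fun x => ∫ y in cube m,
      fderivFst (fun p : (ℝ × ℝ) × (Fin m → ℝ) => V p.1 p.2) (x, y) v * ψ x y := by
  have hd : Continuous (fderivFst fun p : (ℝ × ℝ) × (Fin m → ℝ) => V p.1 p.2) :=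
    (contDiff_fderivFst (k := 0) hV (by norm_cast)).continuous
  have hc : Continuous (Function.uncurry fun (x : ℝ × ℝ) (y : Fin m → ℝ) =>
      fderivFst (fun p : (ℝ × ℝ) × (Fin m → ℝ) => V p.1 p.2) (x, y) v * ψ x y) :=
    (hd.clm_apply continuous_const).mul hψ.continuous
  exact continuous_parametric_integral_of_continuous hc (isCompact_cube m)

theorem contDiff_freeEnergy
    (hV : ContDiff ℝ (⊤ : ℕ∞) (fun p : (ℝ × ℝ) × (Fin m → ℝ) => V p.1 p.2)) :
    ContDiff ℝ (⊤ : ℕ∞) (freeEnergy V) := by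
  have hm := contDiff_marg (ψ := fun x y => Real.exp (-V x y)) hV.neg.exp
  exact (hm.log fun x => (marg_pos (ψ := fun x y => Real.exp (-V x y))
    hV.neg.exp.continuous (fun _ _ => Real.exp_pos _) x).ne').neg

theorem per2_freeEnergy (h : PerN V) : Per2 (freeEnergy V) :=
  ⟨fun x₁ x₂ => by simp only [freeEnergy, h.1], fun x₁ x₂ => by simp only [freeEnergy, h.2.1]⟩

theorem log_div_psiInf (hpos : ∀ x y, 0 < ψ x y) (x : ℝ × ℝ) (y : Fin m → ℝ) :
    Real.log (ψ x y / psiInf V x y) = Real.log (ψ x y) + V x y - freeEnergy V x := by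
  rw [psiInf, Real.log_div (hpos x y).ne' (Real.exp_pos _).ne', Real.log_exp]
  ring

/-- The fiber integral of a derivative of `ln (ψ/ψ_∞)` against `ψ`, in direction `v`. -/
theorem integral_fderivFst_log_div_psiInf_mul
    (hψ : ContDiff ℝ (⊤ : ℕ∞) (fun p : (ℝ × ℝ) × (Fin m → ℝ) => ψ p.1 p.2))
    (hV : ContDiff ℝ (⊤ : ℕ∞) (fun p : (ℝ × ℝ) × (Fin m → ℝ) => V p.1 p.2))
    (hpos : ∀ x y, 0 < ψ x y) (x v : ℝ × ℝ) :
    IntegrableOn (fun y => fderivFst (fun p : (ℝ × ℝ) × (Fin m → ℝ) =>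
        Real.log (ψ p.1 p.2 / psiInf V p.1 p.2)) (x, y) v * ψ x y) (cube m) ∧
    ∫ y in cube m, fderivFst (fun p : (ℝ × ℝ) × (Fin m → ℝ) =>
        Real.log (ψ p.1 p.2 / psiInf V p.1 p.2)) (x, y) v * ψ x y
      = fderiv ℝ (fun x => Real.log (marg ψ x) - freeEnergy V x) x v * marg ψ x
        + ∫ y in cube m,
          fderivFst (fun p : (ℝ × ℝ) × (Fin m → ℝ) => V p.1 p.2) (x, y) v * ψ x y := by
  have h0 : (0 : WithTop ℕ∞) + 1 ≤ ((⊤ : ℕ∞) : WithTop ℕ∞) := by norm_cast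
  have h1 : (1 : WithTop ℕ∞) ≤ ((⊤ : ℕ∞) : WithTop ℕ∞) := by norm_cast
  have hA := (contDiff_freeEnergy hV).differentiable (by simp) x
  have hM := (contDiff_marg hψ).differentiable (by simp) x
  have hdψ : Continuous (fderivFst fun p : (ℝ × ℝ) × (Fin m → ℝ) => ψ p.1 p.2) :=
    (contDiff_fderivFst hψ h0).continuous
  have hdV : Continuous (fderivFst fun p : (ℝ × ℝ) × (Fin m → ℝ) => V p.1 p.2) :=
    (contDiff_fderivFst hV h0).continuous
  have hpt : ∀ y, fderivFst (fun p : (ℝ × ℝ) × (Fin m → ℝ) =>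
        Real.log (ψ p.1 p.2 / psiInf V p.1 p.2)) (x, y) v * ψ x y
      = fderivFst (fun p : (ℝ × ℝ) × (Fin m → ℝ) => ψ p.1 p.2) (x, y) v
        + fderivFst (fun p : (ℝ × ℝ) × (Fin m → ℝ) => V p.1 p.2) (x, y) v * ψ x y
        - fderiv ℝ (freeEnergy V) x v * ψ x y := by
    intro y
    have hψd := (hψ.differentiable (by simp) (x, y)).hasFDerivAt
    have hVd := (hV.differentiable (by simp) (x, y)).hasFDerivAt
    have hAd : HasFDerivAt (fun p : (ℝ × ℝ) × (Fin m → ℝ) => freeEnergy V p.1) _ (x, y) :=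
      HasFDerivAt.comp (g := freeEnergy V) (x, y) hA.hasFDerivAt hasFDerivAt_fst
    have hd := ((hψd.log (hpos x y).ne').add hVd).sub hAd
    have he : (fun p : (ℝ × ℝ) × (Fin m → ℝ) => Real.log (ψ p.1 p.2 / psiInf V p.1 p.2))
        = fun p => Real.log (ψ p.1 p.2) + V p.1 p.2 - freeEnergy V p.1 :=
      funext fun p => log_div_psiInf hpos p.1 p.2
    have hd' := hd.fderiv
    simp only [Pi.add_def, Pi.sub_def] at hd'
    have hne := (hpos x y).ne'
    rw [he]
    simp only [fderivFst, hd', ContinuousLinearMap.comp_apply, sub_apply,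
      add_apply, smul_apply, smul_eq_mul,
      ContinuousLinearMap.inl_apply, ContinuousLinearMap.coe_fst']
    field_simp
  have i1 : IntegrableOn (fun y =>
      fderivFst (fun p : (ℝ × ℝ) × (Fin m → ℝ) => ψ p.1 p.2) (x, y) v) (cube m) :=
    integrableOn_cube (hdψ.clm_apply (continuous_const (y := v))) x
  have i2 : IntegrableOn (fun y =>
      fderivFst (fun p : (ℝ × ℝ) × (Fin m → ℝ) => V p.1 p.2) (x, y) v * ψ x y) (cube m) :=
    integrableOn_cube ((hdV.clm_apply (continuous_const (y := v))).mul hψ.continuous) x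
  have i3 : IntegrableOn (fun y => fderiv ℝ (freeEnergy V) x v * ψ x y) (cube m) :=
    (integrableOn_cube hψ.continuous x).const_mul (fderiv ℝ (freeEnergy V) x v)
  have hMd : fderiv ℝ (marg ψ) x v
      = ∫ y in cube m, fderivFst (fun p : (ℝ × ℝ) × (Fin m → ℝ) => ψ p.1 p.2) (x, y) v := by
    have h := hasFDerivAt_setIntegral_of_contDiff (μ := volume) (hψ.of_le h1)
      (isCompact_cube m) x
    have h' : fderiv ℝ (marg ψ) x = _ := h.fderiv
    rw [h']
    exact ContinuousLinearMap.integral_apply ((hdψ.comp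
      (Continuous.prodMk_right x)).continuousOn.integrableOn_compact (isCompact_cube m)) v
  have hne := (marg_pos hψ.continuous hpos x).ne'
  have hG : fderiv ℝ (fun x => Real.log (marg ψ x) - freeEnergy V x) x v * marg ψ x
      = fderiv ℝ (marg ψ) x v - fderiv ℝ (freeEnergy V) x v * marg ψ x := by
    have h : fderiv ℝ (fun x => Real.log (marg ψ x) - freeEnergy V x) x = _ :=
      ((hM.hasFDerivAt.log hne).sub hA.hasFDerivAt).fderiv
    rw [h]
    simp only [sub_apply, smul_apply, smul_eq_mul]
    field_simp
  simp only [hpt]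
  refine ⟨(i1.add i2).sub i3, ?_⟩
  rw [integral_sub (by exact i1.add i2) i3, integral_add i1 i2, hG, hMd, integral_const_mul]
  simp only [marg]
  ring

end Marginal

/-- The cross term of the entropy estimate is nonpositive: if `∇A_t` is the weighted Helmholtz
projection of `F_t` (weight `ψ^ξ`), then
`∫_{T^n} Σᵢ (∂ᵢA_t − F_t^i) ∂ᵢ ln(ψ/ψ_∞) ψ = −∫_{T²} |∇A_t − F_t|² ψ^ξ ≤ 0`. -/
theorem cross_term_nonpositive {m : ℕ}
    (ψ V : ℝ × ℝ → (Fin m → ℝ) → ℝ) (At : ℝ × ℝ → ℝ)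
    (hψsmooth : ContDiff ℝ (⊤ : ℕ∞) (fun p : (ℝ × ℝ) × (Fin m → ℝ) => ψ p.1 p.2))
    (hVsmooth : ContDiff ℝ (⊤ : ℕ∞) (fun p : (ℝ × ℝ) × (Fin m → ℝ) => V p.1 p.2))
    (hψpos : ∀ x y, 0 < ψ x y) (hψper : PerN ψ) (hVper : PerN V)
    (hψprob : ∫ x in Q2, ∫ y in cube m, ψ x y = 1)
    (hAtsmooth : ContDiff ℝ (⊤ : ℕ∞) At) (hAtper : Per2 At)
    -- weighted Helmholtz projection identity, weight `ψ^ξ`: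
    (hproj : ∀ g : ℝ × ℝ → ℝ, ContDiff ℝ (⊤ : ℕ∞) g → Per2 g →
      ∫ x in Q2, ((pd1 At x - F1 ψ V x) * pd1 g x
          + (pd2 At x - F2 ψ V x) * pd2 g x) * marg ψ x = 0) :
    (∫ x in Q2, ∫ y in cube m,
        ((pd1 At x - F1 ψ V x)
            * pdx1 (fun x' y' => Real.log (ψ x' y' / psiInf V x' y')) x y
          + (pd2 At x - F2 ψ V x)
            * pdx2 (fun x' y' => Real.log (ψ x' y' / psiInf V x' y')) x y) * ψ x y
      = -∫ x in Q2, ((pd1 At x - F1 ψ V x) ^ 2 + (pd2 At x - F2 ψ V x) ^ 2) * marg ψ x) ∧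
    (∫ x in Q2, ∫ y in cube m,
        ((pd1 At x - F1 ψ V x)
            * pdx1 (fun x' y' => Real.log (ψ x' y' / psiInf V x' y')) x y
          + (pd2 At x - F2 ψ V x)
            * pdx2 (fun x' y' => Real.log (ψ x' y' / psiInf V x' y')) x y) * ψ x y
      ≤ 0) := by
  have hMs := contDiff_marg hψsmooth
  have hMpos := marg_pos hψsmooth.continuous hψpos
  have hAs := contDiff_freeEnergy hVsmooth
  have hV1 := fun x y => pdx1_eq_fderivFst (hVsmooth.differentiable (by simp)) x y
  have hV2 := fun x y => pdx2_eq_fderivFst (hVsmooth.differentiable (by simp)) x y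
  have hLs : ContDiff ℝ (⊤ : ℕ∞) (fun p : (ℝ × ℝ) × (Fin m → ℝ) =>
      Real.log (ψ p.1 p.2 / psiInf V p.1 p.2)) := by
    simp only [log_div_psiInf hψpos]
    exact ((hψsmooth.log fun p => (hψpos p.1 p.2).ne').add hVsmooth).sub (hAs.comp contDiff_fst)
  have hBs : ContDiff ℝ (⊤ : ℕ∞) (fun x => Real.log (marg ψ x) - freeEnergy V x) :=
    (hMs.log fun x => (hMpos x).ne').sub hAs
  have hGs : ContDiff ℝ (⊤ : ℕ∞)
      (fun x => Real.log (marg ψ x) - freeEnergy V x + At x) := hBs.add hAtsmooth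
  have hGper : Per2 (fun x => Real.log (marg ψ x) - freeEnergy V x + At x) :=
    ⟨fun a b => by
      simp only [(per2_marg hψper).1, (per2_freeEnergy hVper).1, hAtper.1],
    fun a b => by
      simp only [(per2_marg hψper).2, (per2_freeEnergy hVper).2, hAtper.2]⟩
  have hGd : ∀ x v, fderiv ℝ (fun x => Real.log (marg ψ x) - freeEnergy V x + At x) x v
      = fderiv ℝ (fun x => Real.log (marg ψ x) - freeEnergy V x) x v + fderiv ℝ At x v := by
    intro x v
    rw [fderiv_fun_add (hBs.differentiable (by simp) x) (hAtsmooth.differentiable (by simp) x)]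
    rfl
  have hF1c : Continuous (F1 ψ V) := by
    have h := continuous_integral_fderivFst_mul hψsmooth hVsmooth (1, 0)
    simp only [← hV1] at h
    exact h.div hMs.continuous fun x => (hMpos x).ne'
  have hF2c : Continuous (F2 ψ V) := by
    have h := continuous_integral_fderivFst_mul hψsmooth hVsmooth (0, 1)
    simp only [← hV2] at h
    exact h.div hMs.continuous fun x => (hMpos x).ne'
  have hproj' := hproj _ hGs hGper
  have hpd1 : ∀ {g : ℝ × ℝ → ℝ}, ContDiff ℝ (⊤ : ℕ∞) g → Continuous (pd1 g) := fun {g} hg => by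
    rw [funext (pd1_eq_fderiv (hg.differentiable (by simp)))]
    exact (hg.continuous_fderiv (by simp)).clm_apply continuous_const
  have hpd2 : ∀ {g : ℝ × ℝ → ℝ}, ContDiff ℝ (⊤ : ℕ∞) g → Continuous (pd2 g) := fun {g} hg => by
    rw [funext (pd2_eq_fderiv (hg.differentiable (by simp)))]
    exact (hg.continuous_fderiv (by simp)).clm_apply continuous_const
  have hD1 : Continuous fun x => pd1 At x - F1 ψ V x := (hpd1 hAtsmooth).sub hF1c
  have hD2 : Continuous fun x => pd2 At x - F2 ψ V x := (hpd2 hAtsmooth).sub hF2c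
  have hinner : ∀ x, ∫ y in cube m,
        ((pd1 At x - F1 ψ V x)
            * pdx1 (fun x' y' => Real.log (ψ x' y' / psiInf V x' y')) x y
          + (pd2 At x - F2 ψ V x)
            * pdx2 (fun x' y' => Real.log (ψ x' y' / psiInf V x' y')) x y) * ψ x y
      = ((pd1 At x - F1 ψ V x)
            * pd1 (fun x => Real.log (marg ψ x) - freeEnergy V x + At x) x
          + (pd2 At x - F2 ψ V x)
            * pd2 (fun x => Real.log (marg ψ x) - freeEnergy V x + At x) x) * marg ψ x
        - ((pd1 At x - F1 ψ V x) ^ 2 + (pd2 At x - F2 ψ V x) ^ 2) * marg ψ x := by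
    intro x
    obtain ⟨i1, e1⟩ :=
      integral_fderivFst_log_div_psiInf_mul hψsmooth hVsmooth hψpos x (1, 0)
    obtain ⟨i2, e2⟩ :=
      integral_fderivFst_log_div_psiInf_mul hψsmooth hVsmooth hψpos x (0, 1)
    have f1 : F1 ψ V x * marg ψ x = ∫ y in cube m, pdx1 V x y * ψ x y :=
      div_mul_cancel₀ _ (hMpos x).ne'
    have f2 : F2 ψ V x * marg ψ x = ∫ y in cube m, pdx2 V x y * ψ x y :=
      div_mul_cancel₀ _ (hMpos x).ne'
    simp only [← hV1, ← f1] at e1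
    simp only [← hV2, ← f2] at e2
    simp only [pdx1_eq_fderivFst (f := fun x' y' => Real.log (ψ x' y' / psiInf V x' y'))
        (hLs.differentiable (by simp)),
      pdx2_eq_fderivFst (f := fun x' y' => Real.log (ψ x' y' / psiInf V x' y'))
        (hLs.differentiable (by simp)), add_mul _ _ (ψ _ _), mul_assoc _ _ (ψ _ _)]
    rw [integral_add (i1.const_mul _) (i2.const_mul _), integral_const_mul, integral_const_mul,
      e1, e2, pd1_eq_fderiv (hGs.differentiable (by simp)),
      pd2_eq_fderiv (hGs.differentiable (by simp)), hGd, hGd,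
      ← pd1_eq_fderiv (hAtsmooth.differentiable (by simp)),
      ← pd2_eq_fderiv (hAtsmooth.differentiable (by simp))]
    ring
  have heq : ∫ x in Q2, ∫ y in cube m,
        ((pd1 At x - F1 ψ V x)
            * pdx1 (fun x' y' => Real.log (ψ x' y' / psiInf V x' y')) x y
          + (pd2 At x - F2 ψ V x)
            * pdx2 (fun x' y' => Real.log (ψ x' y' / psiInf V x' y')) x y) * ψ x y
      = -∫ x in Q2, ((pd1 At x - F1 ψ V x) ^ 2 + (pd2 At x - F2 ψ V x) ^ 2) * marg ψ x := by
    simp only [hinner]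
    rw [integral_sub, hproj', zero_sub]
    · exact (((hD1.mul (hpd1 hGs)).add (hD2.mul (hpd2 hGs))).mul
        hMs.continuous).continuousOn.integrableOn_compact isCompact_Q2
    · exact (((hD1.pow 2).add (hD2.pow 2)).mul
        hMs.continuous).continuousOn.integrableOn_compact isCompact_Q2
  refine ⟨heq, heq.le.trans (neg_nonpos.2 (integral_nonneg fun x => ?_))⟩
  exact mul_nonneg (add_nonneg (sq_nonneg _) (sq_nonneg _)) (hMpos x).le
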